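/- The monic quintic f has one real triple root and two distinct real simple roots — i.e., there exist real numbers a, b1, b2, pairwise distinct, with f(X) = (X−a)^3(X−b1)(X−b2) — if and only if D = 0, L1 = 0, L2 > 0 and D2 = 0. -/

import Mathlib

open Polynomial

noncomputable section

def quinticL2 (p q r s : ℝ) : ℝ :=
  3*p^2*q^2 - 45*r^2 - 8*p^3*r + 40*q*s + 38*p*q*r - 16*p^2*s - 12*q^3

def quinticL1 (p q r s t : ℝ) : ℝ :=
  -264*p*r*s^2 - 12*p^3*q^2*t + 36*p*q*r^3 - 124*p*q^2*r*s + 28*p^3*q*r*s + 260*p*q*s*t - 132*p^2*q*r*t + 240*p*r^2*t + 234*q*r^2*s + 32*p^4*r*t + 48*p*q^3*t - 56*p^3*s*t - 80*q^2*r*t + 194*p^2*q*s^2 - 600*r*s*t - 6*p^2*q^3*s + 2*p^2*q^2*r^2 - 12*p^2*r^2*s - 54*r^4 + 320*s^3 - 8*q^3*r^2 - 8*p^3*r^3 + 250*q*t^2 - 176*q^2*s^2 + 24*q^4*s - 36*p^4*s^2 - 100*p^2*t^2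

def quinticD2 (p q r s t : ℝ) : ℝ :=
  24*p^2*q^4*s - 1100*q^3*r*t + 800*p^3*q*s*t - 1735*p^2*q^2*r*t - 3*p^2*q*r^2*s + 20*p*q^3*r*s - 600*p^2*r*s*t - 1150*p*q^2*s*t + 5475*p*q*r^2*t - 1380*p*q*r*s^2 + 1500*q*r*s*t + 6*p^3*q*r^3 + p^4*q^2*r^2 - 128*p^6*r*t + 660*p*q^4*t - 136*p^5*s*t - 3*p^4*q^3*s - 236*p^4*q*s^2 + 337*p^2*q^2*s^2 + 48*p^5*q^2*t - 357*p^3*q^3*t - 12*p^4*r^2*s - 45*p*r^3*s + 60*q^2*r^2*s - 8*p^2*q^3*r^2 - 500*p^2*q*t^2 - 24*p*q^2*r^3 - 1380*p^3*r^2*t + 408*p^3*r*s^2 - 4*p^5*q*r*s + 1028*p^4*q*r*t + 11*p^3*q^2*r*s + 36*p^6*s^2 + 100*p^4*t^2 + 9*p^2*r^4 - 48*q^5*s + 16*q^4*r^2 + 160*q^3*s^2 + 625*q^2*t^2 - 3375*r^3*t + 900*r^2*s^2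

/-- The coefficients `p, q, r, s, t` of a monic quintic are the signed elementary symmetric
functions of `a, b, c, d, e`. -/
def QuinticVieta {R : Type*} [CommRing R] (p q r s t a b c d e : R) : Prop :=
  p = -(a + b + c + d + e) ∧
  q = a*b + a*c + a*d + a*e + b*c + b*d + b*e + c*d + c*e + d*e ∧
  r = -(a*b*c + a*b*d + a*b*e + a*c*d + a*c*e + a*d*e + b*c*d + b*c*e + b*d*e + c*d*e) ∧
  s = a*b*c*d + a*b*c*e + a*b*d*e + a*c*d*e + b*c*d*e ∧
  t = -(a*b*c*d*e)

theorem quintic_coeff_injective {R : Type*} [CommRing R] {p q r s t p' q' r' s' t' : R}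
    (h : (X ^ 5 + C p * X ^ 4 + C q * X ^ 3 + C r * X ^ 2 + C s * X + C t : Polynomial R) =
      X ^ 5 + C p' * X ^ 4 + C q' * X ^ 3 + C r' * X ^ 2 + C s' * X + C t') :
    p = p' ∧ q = q' ∧ r = r' ∧ s = s' ∧ t = t' := by
  refine ⟨?_, ?_, ?_, ?_, ?_⟩
  · simpa [coeff_X, coeff_C, coeff_X_pow] using congrArg (coeff · 4) h
  · simpa [coeff_X, coeff_C, coeff_X_pow] using congrArg (coeff · 3) h
  · simpa [coeff_X, coeff_C, coeff_X_pow] using congrArg (coeff · 2) h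
  · simpa [coeff_X, coeff_C, coeff_X_pow] using congrArg (coeff · 1) h
  · simpa [coeff_X, coeff_C, coeff_X_pow] using congrArg (coeff · 0) h

theorem quintic_eq_prod_iff {R : Type*} [CommRing R] (p q r s t a b c d e : R) :
    (X ^ 5 + C p * X ^ 4 + C q * X ^ 3 + C r * X ^ 2 + C s * X + C t : Polynomial R) =
      (X - C a) * (X - C b) * (X - C c) * (X - C d) * (X - C e) ↔
    QuinticVieta p q r s t a b c d e := by
  have expand (p' q' r' s' t' : R) (h : QuinticVieta p' q' r' s' t' a b c d e) :
      (X ^ 5 + C p' * X ^ 4 + C q' * X ^ 3 + C r' * X ^ 2 + C s' * X + C t' : Polynomial R) =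
        (X - C a) * (X - C b) * (X - C c) * (X - C d) * (X - C e) := by
    obtain ⟨rfl, rfl, rfl, rfl, rfl⟩ := h
    simp only [C_add, C_neg, C_mul]
    ring
  refine ⟨fun h => ?_, expand p q r s t⟩
  rw [← expand _ _ _ _ _ ⟨rfl, rfl, rfl, rfl, rfl⟩] at h
  exact quintic_coeff_injective h

theorem QuinticVieta.ofReal {p q r s t a b c d e : ℝ} (h : QuinticVieta p q r s t a b c d e) :
    QuinticVieta (p : ℂ) q r s t a b c d e := by
  obtain ⟨rfl, rfl, rfl, rfl, rfl⟩ := h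
  refine ⟨?_, ?_, ?_, ?_, ?_⟩ <;> push_cast <;> rfl

section Evaluation

variable {p q r s t : ℝ} {a b c d : ℂ}

theorem quinticL1_of_double (h : QuinticVieta (p : ℂ) q r s t a a b c d) :
    (quinticL1 p q r s t : ℂ) =
      2 * ((a - b) * (a - c) * (a - d) * (b - c) * (b - d) * (c - d)) ^ 2 := by
  obtain ⟨hp, hq, hr, hs, ht⟩ := h
  simp only [quinticL1]
  push_cast
  rw [hp, hq, hr, hs, ht]
  ring

theorem quinticL2_of_triple (h : QuinticVieta (p : ℂ) q r s t a a a b c) :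
    (quinticL2 p q r s : ℂ) = 3 * ((a - b) * (a - c) * (b - c)) ^ 2 := by
  obtain ⟨hp, hq, hr, hs, -⟩ := h
  simp only [quinticL2]
  push_cast
  rw [hp, hq, hr, hs]
  ring

theorem quinticD2_of_triple (h : QuinticVieta (p : ℂ) q r s t a a a b c) :
    (quinticD2 p q r s t : ℂ) = 0 := by
  obtain ⟨hp, hq, hr, hs, ht⟩ := h
  simp only [quinticD2]
  push_cast
  rw [hp, hq, hr, hs, ht]
  ring

theorem quinticL2_of_double_double (h : QuinticVieta (p : ℂ) q r s t a a b b c) :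
    (quinticL2 p q r s : ℂ) = 4 * ((a - b) * (a - c) * (b - c)) ^ 2 := by
  obtain ⟨hp, hq, hr, hs, -⟩ := h
  simp only [quinticL2]
  push_cast
  rw [hp, hq, hr, hs]
  ring

theorem quinticD2_of_double_double (h : QuinticVieta (p : ℂ) q r s t a a b b c) :
    (quinticD2 p q r s t : ℂ) =
      4 * ((a - b) * (a - c) * (b - c)) ^ 4 * (a - b) ^ 2 := by
  obtain ⟨hp, hq, hr, hs, ht⟩ := h
  simp only [quinticD2]
  push_cast
  rw [hp, hq, hr, hs, ht]
  ring

theorem quinticD2_ne_zero_of_double_double (h : QuinticVieta (p : ℂ) q r s t a a b b c)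
    (hL2 : quinticL2 p q r s ≠ 0) : quinticD2 p q r s t ≠ 0 := by
  rw [← Complex.ofReal_ne_zero] at hL2 ⊢
  rw [quinticL2_of_double_double h] at hL2
  rw [quinticD2_of_double_double h]
  simp_all

/-- A triple root of a real quintic is real, provided the other two roots are distinct. -/
theorem conj_eq_of_triple (h : QuinticVieta (p : ℂ) q r s t a a a b c)
    (hbc : b - c ≠ 0) : (starRingEnd ℂ) a = a := by
  obtain ⟨hp, hq, hr, hs, ht⟩ := h
  have hroot : a ^ 5 + p * a ^ 4 + q * a ^ 3 + r * a ^ 2 + s * a + t = 0 := by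
    rw [hp, hq, hr, hs, ht]; ring
  have hderiv : 5 * a ^ 4 + 4 * p * a ^ 3 + 3 * q * a ^ 2 + 2 * r * a + s = 0 := by
    rw [hp, hq, hr, hs]; ring
  replace hroot := congrArg (starRingEnd ℂ) hroot
  replace hderiv := congrArg (starRingEnd ℂ) hderiv
  simp only [map_add, map_mul, map_pow, Complex.conj_ofReal, map_zero, map_ofNat] at hroot hderiv
  generalize (starRingEnd ℂ) a = w at hroot hderiv ⊢
  have hroot' : (w - a) ^ 3 * (w - b) * (w - c) = 0 := by
    rw [← hroot, hp, hq, hr, hs, ht]; ring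
  have hderiv' : (w - a) ^ 2 *
      (3 * (w - b) * (w - c) + (w - a) * (w - b) + (w - a) * (w - c)) = 0 := by
    rw [← hderiv, hp, hq, hr, hs]; ring
  by_contra hne
  have hwa : w - a ≠ 0 := sub_ne_zero.2 hne
  have hsecond := (mul_eq_zero.1 hderiv').resolve_left (pow_ne_zero 2 hwa)
  rcases mul_eq_zero.1 hroot' with h | h
  · have hwb := (mul_eq_zero.1 h).resolve_left (pow_ne_zero 3 hwa)
    have hwc : (w - a) * (w - c) = 0 := by
      linear_combination hsecond - (3 * (w - c) + (w - a)) * hwb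
    exact hbc (by linear_combination (mul_eq_zero.1 hwc).resolve_left hwa - hwb)
  · have hwb : (w - a) * (w - b) = 0 := by
      linear_combination hsecond - (3 * (w - b) + (w - a)) * h
    exact hbc (by linear_combination h - (mul_eq_zero.1 hwb).resolve_left hwa)

theorem exists_real_of_triple (h : QuinticVieta (p : ℂ) q r s t a a a b c)
    (hL2 : 0 < quinticL2 p q r s) :
    ∃ a b1 b2 : ℝ, a ≠ b1 ∧ a ≠ b2 ∧ b1 ≠ b2 ∧ QuinticVieta p q r s t a a a b1 b2 := by
  have hL := quinticL2_of_triple h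
  have hne : 3 * ((a - b) * (a - c) * (b - c)) ^ 2 ≠ 0 := by
    rw [← hL]; exact_mod_cast hL2.ne'
  have hab : a - b ≠ 0 := by rintro h0; simp [h0] at hne
  have hac : a - c ≠ 0 := by rintro h0; simp [h0] at hne
  have hbc : b - c ≠ 0 := by rintro h0; simp [h0] at hne
  obtain ⟨x, rfl⟩ := Complex.conj_eq_iff_real.1 (conj_eq_of_triple h hbc)
  have hsum : b + c = ((-p - 3 * x : ℝ) : ℂ) := by
    push_cast; rw [h.1]; ring
  have hprod : (x - b) * (x - c) = ((q - 2 * x ^ 2 - 4 * x * (-p - 3 * x) : ℝ) : ℂ) := by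
    push_cast; rw [h.1, h.2.1]; ring
  generalize -p - 3 * x = u at hsum hprod
  generalize q - 2 * x ^ 2 - 4 * x * u = n at hprod
  have hn : n ≠ 0 := by
    rintro rfl
    simp [hab, hac] at hprod
  rw [hprod, mul_pow] at hL
  have hsq : (b - c) ^ 2 = ((quinticL2 p q r s / (3 * n ^ 2) : ℝ) : ℂ) := by
    have : (n : ℂ) ≠ 0 := by exact_mod_cast hn
    push_cast
    rw [hL]
    field_simp
  have hpos : 0 < quinticL2 p q r s / (3 * n ^ 2) := by positivity
  generalize quinticL2 p q r s / (3 * n ^ 2) = v at hsq hpos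
  have him : (b - c).im = 0 := by
    have h1 := congrArg Complex.re hsq
    have h2 := congrArg Complex.im hsq
    simp only [pow_two, Complex.mul_re, Complex.mul_im, Complex.ofReal_re,
      Complex.ofReal_im] at h1 h2
    by_contra h0
    have h3 : (b - c).re = 0 := by
      have : (b - c).re * (b - c).im = 0 := by linarith
      exact (mul_eq_zero.1 this).resolve_right h0
    rw [h3] at h1
    nlinarith [mul_self_nonneg (b - c).im]
  have hsumim := congrArg Complex.im hsum
  simp only [Complex.sub_im, Complex.add_im, Complex.ofReal_im] at him hsumim
  have hb : ((b.re : ℝ) : ℂ) = b := Complex.ext rfl (by simp; linarith)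
  have hc : ((c.re : ℝ) : ℂ) = c := Complex.ext rfl (by simp; linarith)
  rw [← hb, ← hc] at h
  rw [← hb] at hab hbc
  rw [← hc] at hac hbc
  rw [sub_ne_zero] at hab hac hbc
  refine ⟨x, b.re, c.re, by exact_mod_cast hab, by exact_mod_cast hac, by exact_mod_cast hbc, ?_⟩
  obtain ⟨hp, hq, hr, hs, ht⟩ := h
  exact ⟨by exact_mod_cast hp, by exact_mod_cast hq, by exact_mod_cast hr, by exact_mod_cast hs,
    by exact_mod_cast ht⟩

theorem exists_triple_of_double (h : QuinticVieta (p : ℂ) q r s t a a b c d)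
    (hL1 : quinticL1 p q r s t = 0) (hL2 : quinticL2 p q r s ≠ 0)
    (hD2 : quinticD2 p q r s t = 0) :
    ∃ a b c : ℂ, QuinticVieta (p : ℂ) q r s t a a a b c := by
  have hL := quinticL1_of_double h
  rw [hL1] at hL
  simp only [Complex.ofReal_zero, zero_eq_mul, OfNat.ofNat_ne_zero, false_or, pow_eq_zero_iff,
    ne_eq, not_false_eq_true, mul_eq_zero, sub_eq_zero] at hL
  have perm {b' c' d' : ℂ}
      (hperm : (X - C b) * (X - C c) * (X - C d) = (X - C b') * (X - C c') * (X - C d')) :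
      QuinticVieta (p : ℂ) q r s t a a b' c' d' := by
    rw [← quintic_eq_prod_iff] at h ⊢
    rw [h]
    linear_combination (X - C a) ^ 2 * hperm
  rcases hL with ((((rfl | rfl) | rfl) | rfl) | rfl) | rfl
  · exact ⟨a, c, d, h⟩
  · exact ⟨a, b, d, perm (by ring)⟩
  · exact ⟨a, b, c, perm (by ring)⟩
  · exact absurd hD2 (quinticD2_ne_zero_of_double_double h hL2)
  · exact absurd hD2 (quinticD2_ne_zero_of_double_double (c := c) (perm (by ring)) hL2)
  · exact absurd hD2 (quinticD2_ne_zero_of_double_double (b := c) (c := b) (perm (by ring)) hL2)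

end Evaluation

theorem exists_double_of_not_injective {p q r s t : ℂ} {z : Fin 5 → ℂ}
    (hf : (X ^ 5 + C p * X ^ 4 + C q * X ^ 3 + C r * X ^ 2 + C s * X + C t : Polynomial ℂ) =
      ∏ i : Fin 5, (X - C (z i)))
    (hz : ¬ Function.Injective z) :
    ∃ a b c d : ℂ, QuinticVieta p q r s t a a b c d := by
  obtain ⟨i, j, hij, hne⟩ := Function.not_injective_iff.1 hz
  obtain ⟨σ, rfl, rfl⟩ : ∃ σ : Equiv.Perm (Fin 5), σ 0 = i ∧ σ 1 = j := by
    refine ⟨Equiv.swap 0 i * Equiv.swap 1 (Equiv.swap 0 i j), ?_⟩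
    clear hf hz hij
    revert i j
    decide
  rw [← Equiv.prod_comp σ, Fin.prod_univ_five, ← hij] at hf
  exact ⟨_, _, _, _, (quintic_eq_prod_iff ..).1 hf⟩

theorem prod_sq_sub_eq_zero_iff {R : Type*} [CommRing R] [IsDomain R] {n : ℕ} (z : Fin n → R) :
    ∏ i, ∏ j ∈ Finset.Ioi i, (z i - z j) ^ 2 = 0 ↔ ¬ Function.Injective z := by
  simp only [Finset.prod_eq_zero_iff, Finset.mem_univ, true_and, Finset.mem_Ioi,
    pow_eq_zero_iff two_ne_zero, sub_eq_zero, Function.not_injective_iff]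
  constructor
  · rintro ⟨i, j, hlt, h⟩
    exact ⟨i, j, h, hlt.ne⟩
  · rintro ⟨i, j, h, hne⟩
    rcases hne.lt_or_gt with hlt | hlt
    · exact ⟨i, j, hlt, h⟩
    · exact ⟨j, i, hlt, h.symm⟩

theorem quintic_triple_two_real_singles (p q r s t D : ℝ) (z : Fin 5 → ℂ)
    (hf : (X ^ 5 + C (p : ℂ) * X ^ 4 + C (q : ℂ) * X ^ 3 + C (r : ℂ) * X ^ 2 + C (s : ℂ) * X + C (t : ℂ) : Polynomial ℂ) = ∏ i : Fin 5, (X - C (z i)))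
    (hD : (D : ℂ) = ∏ i : Fin 5, ∏ j ∈ Finset.Ioi i, (z i - z j) ^ 2) :
    (∃ a b1 b2 : ℝ, a ≠ b1 ∧ a ≠ b2 ∧ b1 ≠ b2 ∧
      (X ^ 5 + C p * X ^ 4 + C q * X ^ 3 + C r * X ^ 2 + C s * X + C t : Polynomial ℝ) =
        (X - C a) ^ 3 * (X - C b1) * (X - C b2)) ↔
    (D = 0 ∧ quinticL1 p q r s t = 0 ∧ 0 < quinticL2 p q r s ∧ quinticD2 p q r s t = 0) := by
  have hD' : D = 0 ↔ ¬ Function.Injective z := by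
    rw [← Complex.ofReal_eq_zero, hD, prod_sq_sub_eq_zero_iff]
  have hvieta (a b1 b2 : ℝ) :
      (X ^ 5 + C p * X ^ 4 + C q * X ^ 3 + C r * X ^ 2 + C s * X + C t : Polynomial ℝ) =
        (X - C a) ^ 3 * (X - C b1) * (X - C b2) ↔ QuinticVieta p q r s t a a a b1 b2 := by
    rw [← quintic_eq_prod_iff, pow_three' (X - C a)]
  simp only [hvieta]
  constructor
  · rintro ⟨a, b1, b2, h1, h2, h12, h⟩
    replace h := h.ofReal
    refine ⟨?_, ?_, ?_, ?_⟩
    · rw [hD', ← separable_prod_X_sub_C_iff, ← hf, (quintic_eq_prod_iff ..).2 h]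
      intro hsep
      refine not_isUnit_X_sub_C (a : ℂ) (hsep.squarefree _ ?_)
      exact ⟨(X - C (a : ℂ)) * (X - C (b1 : ℂ)) * (X - C (b2 : ℂ)), by ring⟩
    · have := quinticL1_of_double h
      rw [sub_self] at this
      simpa using this
    · have hL : quinticL2 p q r s = 3 * ((a - b1) * (a - b2) * (b1 - b2)) ^ 2 := by
        exact_mod_cast quinticL2_of_triple h
      have := mul_ne_zero (mul_ne_zero (sub_ne_zero.2 h1) (sub_ne_zero.2 h2)) (sub_ne_zero.2 h12)
      rw [hL]
      positivity
    · exact_mod_cast quinticD2_of_triple h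
  · rintro ⟨h0, hL1, hL2, hD2⟩
    obtain ⟨a, b, c, d, h⟩ := exists_double_of_not_injective hf (hD'.1 h0)
    obtain ⟨a, b, c, h⟩ := exists_triple_of_double h hL1 hL2.ne' hD2
    exact exists_real_of_triple h hL2
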